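/- Let m ≥ 2, let σ₁σ₂⋯σ_N be a finite word with each σ_j ∈ {0, 1}, and let λ = ((n₁, …, n_m), (k₁, …, k_m)) be a pair of integer m-tuples. If T̃_{σ_N} ∘ ⋯ ∘ T̃_{σ₁}(λ) = ((n̄₁, …, n̄_m), (k̄₁, …, k̄_m)), then applying the maps in reversed order to the conjugate of the result recovers the conjugate of λ: T̃_{σ₁} ∘ ⋯ ∘ T̃_{σ_N}( C((n̄₁, …, n̄_m), (k̄₁, …, k̄_m)) ) = C(λ). -/

import Mathlib

/-- Parts component of the branch `T̃₀` of the extended slow-Triangle map: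
`(n₁, …, n_m) ↦ (n₂, n₃, …, n_m, n₁ − n₂)` (entries are indexed `1, …, m`;
all other indices are left unchanged). -/
def Tpart0 (m : ℕ) (f : ℕ → ℤ) : ℕ → ℤ := fun i =>
  if 1 ≤ i ∧ i < m then f (i + 1) else if i = m then f 1 - f 2 else f i

/-- Multiplicities component of `T̃₀`: `(k₁, …, k_m) ↦ (k₁ + k₂, k₃, …, k_m, k₁)`. -/
def Tmult0 (m : ℕ) (g : ℕ → ℤ) : ℕ → ℤ := fun i =>
  if i = 1 then g 1 + g 2
  else if 2 ≤ i ∧ i < m then g (i + 1)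
  else if i = m then g 1 else g i

/-- Parts component of `T̃₁`: `(n₁, …, n_m) ↦ (n₁ − n_m, n₂, …, n_m)`. -/
def Tpart1 (m : ℕ) (f : ℕ → ℤ) : ℕ → ℤ := fun i =>
  if i = 1 then f 1 - f m else f i

/-- Multiplicities component of `T̃₁`: `(k₁, …, k_m) ↦ (k₁, …, k_{m−1}, k₁ + k_m)`. -/
def Tmult1 (m : ℕ) (g : ℕ → ℤ) : ℕ → ℤ := fun i =>
  if i = m then g 1 + g m else g i

/-- The branch `T̃₀` of the extended slow-Triangle map, acting on pairs of `m`-tuples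
(parts, multiplicities), encoded as pairs of functions `ℕ → ℤ` indexed by `1, …, m`. -/
def Ttilde0 (m : ℕ) (p : (ℕ → ℤ) × (ℕ → ℤ)) : (ℕ → ℤ) × (ℕ → ℤ) :=
  (Tpart0 m p.1, Tmult0 m p.2)

/-- The branch `T̃₁` of the extended slow-Triangle map. -/
def Ttilde1 (m : ℕ) (p : (ℕ → ℤ) × (ℕ → ℤ)) : (ℕ → ℤ) × (ℕ → ℤ) :=
  (Tpart1 m p.1, Tmult1 m p.2)

/-- Conjugation (flipping the Young shape) of the partition
`(n₁, …, n_m) × [k₁, …, k_m]`: the new parts are `n'_i = k₁ + ⋯ + k_{m+1−i}` and the new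
multiplicities are `k'_i = n_{m+1−i} − n_{m+2−i}`, with the convention `n_{m+1} = 0`. -/
def Cconj (m : ℕ) (p : (ℕ → ℤ) × (ℕ → ℤ)) : (ℕ → ℤ) × (ℕ → ℤ) :=
  (fun i => if 1 ≤ i ∧ i ≤ m then ∑ j ∈ Finset.Icc 1 (m + 1 - i), p.2 j else p.1 i,
   fun i => if 1 ≤ i ∧ i ≤ m then
      p.1 (m + 1 - i) - (if i = 1 then 0 else p.1 (m + 2 - i)) else p.2 i)

/-- The branch of the extended slow-Triangle map indexed by a binary digit. -/
def Tb (m : ℕ) (b : Bool) : (ℕ → ℤ) × (ℕ → ℤ) → (ℕ → ℤ) × (ℕ → ℤ) :=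
  if b then Ttilde1 m else Ttilde0 m

/-- `applyWord m [σ₁, …, σ_N] λ = T̃_{σ_N} ∘ ⋯ ∘ T̃_{σ₁} (λ)`. -/
def applyWord (m : ℕ) (σ : List Bool) (p : (ℕ → ℤ) × (ℕ → ℤ)) : (ℕ → ℤ) × (ℕ → ℤ) :=
  σ.foldl (fun q b => Tb m b q) p

theorem sum_Icc_Tmult0_of_lt {m : ℕ} (g : ℕ → ℤ) {j : ℕ} (hj : 1 ≤ j) (hjm : j < m) :
    ∑ i ∈ Finset.Icc 1 j, Tmult0 m g i = ∑ i ∈ Finset.Icc 1 (j + 1), g i := by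
  induction j, hj using Nat.le_induction with
  | base => simp [Tmult0, Finset.sum_Icc_succ_top]
  | succ j hj ih =>
    rw [Finset.sum_Icc_succ_top (by omega), ih (by omega),
      Finset.sum_Icc_succ_top (b := j + 1) (by omega)]
    grind [Tmult0]

theorem sum_Icc_Tmult0_self {m : ℕ} (hm : 2 ≤ m) (g : ℕ → ℤ) :
    ∑ i ∈ Finset.Icc 1 m, Tmult0 m g i = ∑ i ∈ Finset.Icc 1 m, g i + g 1 := by
  obtain ⟨j, rfl⟩ : ∃ j, m = j + 1 := ⟨m - 1, by omega⟩
  rw [Finset.sum_Icc_succ_top (by omega), sum_Icc_Tmult0_of_lt g (by omega) (by omega)]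
  grind [Tmult0]

theorem sum_Icc_Tmult1_of_lt {m : ℕ} (g : ℕ → ℤ) {j : ℕ} (hjm : j < m) :
    ∑ i ∈ Finset.Icc 1 j, Tmult1 m g i = ∑ i ∈ Finset.Icc 1 j, g i := by
  refine Finset.sum_congr rfl fun i hi => ?_
  rw [Finset.mem_Icc] at hi
  grind [Tmult1]

theorem sum_Icc_Tmult1_self {m : ℕ} (hm : 2 ≤ m) (g : ℕ → ℤ) :
    ∑ i ∈ Finset.Icc 1 m, Tmult1 m g i = ∑ i ∈ Finset.Icc 1 m, g i + g 1 := by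
  obtain ⟨j, rfl⟩ : ∃ j, m = j + 1 := ⟨m - 1, by omega⟩
  rw [Finset.sum_Icc_succ_top (by omega), sum_Icc_Tmult1_of_lt g (by omega),
    Finset.sum_Icc_succ_top (by omega)]
  grind [Tmult1]

theorem Ttilde0_Cconj_Ttilde0 {m : ℕ} (hm : 2 ≤ m) (p : (ℕ → ℤ) × (ℕ → ℤ)) :
    Ttilde0 m (Cconj m (Ttilde0 m p)) = Cconj m p := by
  obtain ⟨f, g⟩ := p
  have sum_lt := @sum_Icc_Tmult0_of_lt m g
  have sum_self := sum_Icc_Tmult0_self hm g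
  have sum_one : ∑ i ∈ Finset.Icc 1 1, g i = g 1 := by simp
  refine Prod.ext (funext fun i => ?_) (funext fun i => ?_)
  · simp only [Ttilde0, Cconj, Tpart0]
    grind [Tpart0]
  · simp only [Ttilde0, Cconj, Tmult0]
    grind [Tpart0, Tmult0]

theorem Ttilde1_Cconj_Ttilde1 {m : ℕ} (hm : 2 ≤ m) (p : (ℕ → ℤ) × (ℕ → ℤ)) :
    Ttilde1 m (Cconj m (Ttilde1 m p)) = Cconj m p := by
  obtain ⟨f, g⟩ := p
  have sum_lt := @sum_Icc_Tmult1_of_lt m g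
  have sum_self := sum_Icc_Tmult1_self hm g
  have sum_one : ∑ i ∈ Finset.Icc 1 1, g i = g 1 := by simp
  refine Prod.ext (funext fun i => ?_) (funext fun i => ?_)
  · simp only [Ttilde1, Cconj, Tpart1]
    grind [Tpart1, Tmult1]
  · simp only [Ttilde1, Cconj, Tmult1]
    grind [Tpart1, Tmult1]

theorem Tb_Cconj_Tb {m : ℕ} (hm : 2 ≤ m) (b : Bool) (p : (ℕ → ℤ) × (ℕ → ℤ)) :
    Tb m b (Cconj m (Tb m b p)) = Cconj m p := by
  cases b
  · exact Ttilde0_Cconj_Ttilde0 hm p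
  · exact Ttilde1_Cconj_Ttilde1 hm p

/-- Power of palindromes, higher dimension: if `T̃_{σ_N} ∘ ⋯ ∘ T̃_{σ₁}(λ) = λ̄`, then
applying the maps in reversed order to the conjugate of `λ̄` recovers the conjugate
of `λ`. -/
theorem triangle_palindrome_conjugation (m : ℕ) (hm : 2 ≤ m) (σ : List Bool)
    (p q : (ℕ → ℤ) × (ℕ → ℤ)) (h : applyWord m σ p = q) :
    applyWord m σ.reverse (Cconj m q) = Cconj m p := by
  subst h
  induction σ generalizing p with
  | nil => rfl
  | cons b σ ih =>
    have step : applyWord m (b :: σ).reverse = Tb m b ∘ applyWord m σ.reverse := by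
      funext r
      simp [applyWord]
    rw [step, Function.comp_apply]
    change Tb m b (applyWord m σ.reverse (Cconj m (applyWord m σ (Tb m b p)))) = _
    rw [ih, Tb_Cconj_Tb hm]
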